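/- arXiv:2401.16929 — 4 statements merged into one kernel-verified Lean document; each statement's English description precedes it below -/
import Mathlib

section
/- Let n ≥ 2 be an integer and let a₁ ≥ a₂ ≥ … ≥ aₙ be real numbers. Set b = (∑_{i=1}^n aᵢ)² − (n−1)·∑_{i=1}^n aᵢ². Then for every pair of distinct indices i ≠ j one has aᵢ·aⱼ ≥ b / (2(n−1)). -/
/-- Lemma 6.2 (lemsum), main inequality: for `n ≥ 2` real numbers
`a₁ ≥ a₂ ≥ … ≥ aₙ` and `b = (∑ aᵢ)² − (n−1)·∑ aᵢ²`, every pair of distinct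
indices satisfies `aᵢ·aⱼ ≥ b / (2(n−1))`. -/
theorem lemsum_main_inequality (n : ℕ) (hn : 2 ≤ n) (a : Fin n → ℝ)
    (hmono : ∀ i j : Fin n, i ≤ j → a j ≤ a i)
    (b : ℝ) (hb : b = (∑ i, a i) ^ 2 - ((n : ℝ) - 1) * ∑ i, (a i) ^ 2) :
    ∀ i j : Fin n, i ≠ j → a i * a j ≥ b / (2 * ((n : ℝ) - 1)) := by
  intro i j hij
  have hn' : (2 : ℝ) ≤ n := by exact_mod_cast hn
  have hi : i ∈ Finset.univ.erase j := by simp [hij]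
  have key := sq_sum_le_card_mul_sum_sq (s := Finset.univ.erase j)
    (f := fun k => a k + if k = i then a j else 0)
  have h1 : ∑ k ∈ Finset.univ.erase j, (a k + if k = i then a j else 0) = ∑ k, a k := by
    rw [Finset.sum_add_distrib, Finset.sum_ite_eq', if_pos hi,
      Finset.sum_erase_add _ _ (Finset.mem_univ j)]
  have h2 : ∑ k ∈ Finset.univ.erase j, (a k + if k = i then a j else 0) ^ 2
      = ∑ k, a k ^ 2 + 2 * (a i * a j) := by
    have h3 : ∀ k, (a k + if k = i then a j else 0) ^ 2
        = a k ^ 2 + if k = i then 2 * (a i * a j) + a j ^ 2 else 0 := by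
      intro k
      split_ifs with h
      · subst h; ring
      · ring
    simp only [h3]
    rw [Finset.sum_add_distrib, Finset.sum_ite_eq', if_pos hi,
      ← Finset.sum_erase_add _ _ (Finset.mem_univ j)]
    ring
  have hc : ((Finset.univ.erase j).card : ℝ) = (n : ℝ) - 1 := by
    rw [Finset.card_erase_of_mem (Finset.mem_univ j), Finset.card_univ, Fintype.card_fin,
      Nat.cast_sub (by omega), Nat.cast_one]
  rw [h1, h2, hc] at key
  rw [ge_iff_le, div_le_iff₀ (by linarith), hb]
  linarith
end

section
/- Let n ≥ 2 be an integer and let a₁, a₂, …, aₙ be real numbers. If (∑_{i=1}^n aᵢ)² − (n−1)·∑_{i=1}^n aᵢ² ≥ 0, then either aᵢ ≥ 0 for every i, or aᵢ ≤ 0 for every i. -/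
/-- Lemma 6.2 (lemsum), sign conclusion: if
`(∑ aᵢ)² − (n−1)·∑ aᵢ² ≥ 0` then either all `aᵢ ≥ 0` or all `aᵢ ≤ 0`. -/
theorem lemsum_sign_conclusion (n : ℕ) (hn : 2 ≤ n) (a : Fin n → ℝ)
    (hb : (∑ i, a i) ^ 2 - ((n : ℝ) - 1) * ∑ i, (a i) ^ 2 ≥ 0) :
    (∀ i, 0 ≤ a i) ∨ (∀ i, a i ≤ 0) := by
  by_contra hcon
  rw [not_or, not_forall, not_forall] at hcon
  obtain ⟨⟨i, hi⟩, ⟨j, hj⟩⟩ := hcon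
  rw [not_le] at hi hj
  have hij : i ≠ j := by
    rintro rfl
    linarith
  have hmem : i ∈ Finset.univ.erase j := Finset.mem_erase.2 ⟨hij, Finset.mem_univ _⟩
  have h := sq_sum_le_card_mul_sum_sq (s := Finset.univ.erase j)
    (f := fun k => if k = i then a i + a j else a k)
  have hcard : (((Finset.univ : Finset (Fin n)).erase j).card : ℝ) = (n : ℝ) - 1 := by
    rw [Finset.card_erase_of_mem (Finset.mem_univ _), Finset.card_univ, Fintype.card_fin,
      Nat.cast_sub (by omega), Nat.cast_one]
  have e1 : ∑ k ∈ (Finset.univ.erase j).erase i, (if k = i then a i + a j else a k)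
      = ∑ k ∈ (Finset.univ.erase j).erase i, a k :=
    Finset.sum_congr rfl fun k hk => if_neg (Finset.ne_of_mem_erase hk)
  have e2 : ∑ k ∈ (Finset.univ.erase j).erase i, (if k = i then a i + a j else a k) ^ 2
      = ∑ k ∈ (Finset.univ.erase j).erase i, a k ^ 2 :=
    Finset.sum_congr rfl fun k hk => by rw [if_neg (Finset.ne_of_mem_erase hk)]
  rw [hcard, ← Finset.add_sum_erase _ _ hmem,
    ← Finset.add_sum_erase _ (fun k => (if k = i then a i + a j else a k) ^ 2) hmem] at h
  simp only [if_true] at h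
  rw [e1, e2] at h
  rw [← Finset.add_sum_erase _ _ (Finset.mem_univ j), ← Finset.add_sum_erase _ _ hmem,
    ← Finset.add_sum_erase _ (fun k => a k ^ 2) (Finset.mem_univ j),
    ← Finset.add_sum_erase _ (fun k => a k ^ 2) hmem] at hb
  have hn' : (2 : ℝ) ≤ n := by exact_mod_cast hn
  have hp : 0 < ((n : ℝ) - 1) * (-(a i) * a j) :=
    mul_pos (by linarith) (mul_pos (by linarith) hj)
  nlinarith
end

section
/- Let n > 2 be an integer and let a₁, a₂, …, aₙ be real numbers. Set b = (∑_{i=1}^n aᵢ)² − (n−1)·∑_{i=1}^n aᵢ². Then (∑_{i=1}^{n−1} aᵢ)² ≥ (n−2)·∑_{i=1}^{n−1} aᵢ² + ((n−2)/(n−1))·b, and equality holds if and only if aₙ = (1/(n−2))·∑_{i=1}^{n−1} aᵢ. -/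
/-- Key intermediate inequality (6.1) in the proof of Lemma 6.2 (lemsum):
for `n > 2` real numbers `a₁, …, aₙ` (indexed here as `a 0, …, a (n-1)`) and
`b = (∑_{i=1}^n aᵢ)² − (n−1)·∑_{i=1}^n aᵢ²`, one has
`(∑_{i=1}^{n−1} aᵢ)² ≥ (n−2)·∑_{i=1}^{n−1} aᵢ² + ((n−2)/(n−1))·b`, with
equality iff `aₙ = (1/(n−2))·∑_{i=1}^{n−1} aᵢ`. -/
theorem lemsum_intermediate_inequality (n : ℕ) (hn : 2 < n) (a : ℕ → ℝ)
    (b : ℝ)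
    (hb : b = (∑ i ∈ Finset.range n, a i) ^ 2 -
      ((n : ℝ) - 1) * ∑ i ∈ Finset.range n, (a i) ^ 2) :
    (∑ i ∈ Finset.range (n - 1), a i) ^ 2 ≥
      ((n : ℝ) - 2) * ∑ i ∈ Finset.range (n - 1), (a i) ^ 2 +
        (((n : ℝ) - 2) / ((n : ℝ) - 1)) * b ∧
    ((∑ i ∈ Finset.range (n - 1), a i) ^ 2 =
      ((n : ℝ) - 2) * ∑ i ∈ Finset.range (n - 1), (a i) ^ 2 +
        (((n : ℝ) - 2) / ((n : ℝ) - 1)) * b ↔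
      a (n - 1) = (1 / ((n : ℝ) - 2)) * ∑ i ∈ Finset.range (n - 1), a i) := by
  obtain ⟨k, rfl⟩ : ∃ k, n = k + 1 := ⟨n - 1, by omega⟩
  have hk : (2 : ℝ) ≤ (k : ℝ) := by exact_mod_cast (by omega : 2 ≤ k)
  rw [Finset.sum_range_succ, Finset.sum_range_succ] at hb
  simp only [Nat.add_sub_cancel]
  push_cast at hb ⊢
  generalize (∑ i ∈ Finset.range k, a i) = S at *
  generalize (∑ i ∈ Finset.range k, (a i) ^ 2) = Q at *
  generalize a k = x at *
  generalize (k : ℝ) = t at *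
  have h1 : t + 1 - 1 = t := by ring
  have h2 : t + 1 - 2 = t - 1 := by ring
  rw [h1] at hb
  rw [h1, h2]
  have ht : t ≠ 0 := by linarith
  have ht1 : t - 1 ≠ 0 := by linarith
  have key : S ^ 2 - ((t - 1) * Q + (t - 1) / t * b) = (S - (t - 1) * x) ^ 2 / t := by
    rw [hb]
    field_simp
    ring
  have hpos : 0 ≤ (S - (t - 1) * x) ^ 2 / t := by positivity
  refine ⟨by linarith, ?_⟩
  rw [← sub_eq_zero, key, div_eq_zero_iff, or_iff_left ht, sq_eq_zero_iff, sub_eq_zero,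
    one_div, eq_inv_mul_iff_mul_eq₀ ht1, eq_comm]
end

section
/- Let n ≥ 2 be an integer, β > 0 and κ real numbers, a, b real numbers, and define φ : ℝ → ℝ by φ(t) = a·sinh(√β·t) + b·cosh(√β·t) and R : ℝ → ℝ by R(t) = −2(n−1)β + (n−1)·(κ − (n−2)·(φ'(t))²)/(φ(t))², where φ' denotes the derivative of φ. Suppose there is a nonempty open interval I on which φ never vanishes and on which R is equal to a constant c. Then c = −n(n−1)β; in particular c < 0. -/
/-- Proposition 2.2, case `φ(t) = a·sinh(√β t) + b·cosh(√β t)`: if the scalar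
curvature `R(t) = −2(n−1)β + (n−1)(κ − (n−2)φ'(t)²)/φ(t)²` is constant equal to
`c` on a nonempty open interval where `φ` never vanishes, then
`c = −n(n−1)β < 0`. -/
theorem hyperbolic_warped_scalar_curvature (n : ℕ) (hn : 2 ≤ n)
    (β κ a b c t₁ t₂ : ℝ) (hβ : 0 < β) (ht : t₁ < t₂)
    (φ : ℝ → ℝ)
    (hφ : ∀ t, φ t = a * Real.sinh (Real.sqrt β * t) + b * Real.cosh (Real.sqrt β * t))
    (R : ℝ → ℝ)
    (hR : ∀ t, R t = -2 * ((n : ℝ) - 1) * β +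
      ((n : ℝ) - 1) * (κ - ((n : ℝ) - 2) * (deriv φ t) ^ 2) / (φ t) ^ 2)
    (hne : ∀ t ∈ Set.Ioo t₁ t₂, φ t ≠ 0)
    (hc : ∀ t ∈ Set.Ioo t₁ t₂, R t = c) :
    c = -(n : ℝ) * ((n : ℝ) - 1) * β ∧ c < 0 := by
  have hs : Real.sqrt β ^ 2 = β := Real.sq_sqrt hβ.le
  have hspos : 0 < Real.sqrt β := Real.sqrt_pos.mpr hβ
  set s := Real.sqrt β with hsdef
  have hn2 : (2 : ℝ) ≤ n := by exact_mod_cast hn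
  have hφf : φ = fun t => a * Real.sinh (s * t) + b * Real.cosh (s * t) := funext hφ
  have hlin : ∀ t, HasDerivAt (fun t : ℝ => s * t) s t := fun t => by
    simpa using (hasDerivAt_id t).const_mul s
  let ψ : ℝ → ℝ := fun t => a * (Real.cosh (s * t) * s) + b * (Real.sinh (s * t) * s)
  have hd : ∀ t, HasDerivAt φ (ψ t) t := fun t => by
    rw [hφf]
    exact ((hlin t).sinh.const_mul a).add ((hlin t).cosh.const_mul b)
  have hd2 : ∀ t, HasDerivAt ψ (β * φ t) t := fun t => by
    have h := (((hlin t).cosh.mul_const s).const_mul a).add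
      (((hlin t).sinh.mul_const s).const_mul b)
    refine h.congr_deriv ?_
    rw [hφ t, ← hs]; ring
  have hid : ∀ t, ψ t ^ 2 = β * φ t ^ 2 + β * (a ^ 2 - b ^ 2) := fun t => by
    have h := Real.cosh_sq (s * t)
    rw [hφ t, ← hs]
    simp only [ψ]
    linear_combination (s ^ 2 * (a ^ 2 - b ^ 2)) * h
  have key : ∀ t ∈ Set.Ioo t₁ t₂, (c + n * ((n : ℝ) - 1) * β) * φ t ^ 2 =
      ((n : ℝ) - 1) * (κ - ((n : ℝ) - 2) * (β * (a ^ 2 - b ^ 2))) := fun t h => by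
    have h0 := hne t h
    have h1 := hc t h
    rw [hR t, (hd t).deriv, hid t] at h1
    rw [← h1]
    field_simp
    ring
  have hd0 : c + n * ((n : ℝ) - 1) * β = 0 := by
    by_contra hdne
    have hψ0 : ∀ t ∈ Set.Ioo t₁ t₂, ψ t = 0 := fun t h => by
      have hev : (fun t => (c + n * ((n : ℝ) - 1) * β) * φ t ^ 2) =ᶠ[nhds t]
          fun _ => ((n : ℝ) - 1) * (κ - ((n : ℝ) - 2) * (β * (a ^ 2 - b ^ 2))) :=
        Filter.eventually_of_mem (isOpen_Ioo.mem_nhds h) key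
      have h1 := (((hd t).pow 2).const_mul (c + n * ((n : ℝ) - 1) * β))
      have h2 := h1.unique ((hasDerivAt_const t _).congr_of_eventuallyEq hev)
      have h0 := hne t h
      simpa [hdne, h0] using h2
    have hm : (t₁ + t₂) / 2 ∈ Set.Ioo t₁ t₂ := ⟨by linarith, by linarith⟩
    have hev : ψ =ᶠ[nhds ((t₁ + t₂) / 2)] fun _ => (0 : ℝ) :=
      Filter.eventually_of_mem (isOpen_Ioo.mem_nhds hm) hψ0
    have h2 := (hd2 _).unique ((hasDerivAt_const _ _).congr_of_eventuallyEq hev)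
    exact (mul_ne_zero hβ.ne' (hne _ hm)) h2
  have hpos : 0 < (n : ℝ) * ((n : ℝ) - 1) * β :=
    mul_pos (mul_pos (by linarith) (by linarith)) hβ
  exact ⟨by linarith, by linarith⟩
end
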